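/- arXiv:1805.02954 — 3 statements merged into one kernel-verified Lean document; each statement's English description precedes it below -/
import Mathlib

section
/- If c and d are rational formal power series over finite sub-alphabets X_c and X_d of the extended alphabet X̄, then there exists R̂ > 0 such that for every input sequence û with ‖û‖_∞ ≤ R̂ the three series defining F̂_c[û](N), F̂_d[û](N), and F̂_{c⊛d}[û](N) converge absolutely for all N ≥ 1, and F̂_c[û](N) · F̂_d[û](N) = F̂_{c⊛d}[û](N); moreover e = c ⊛ d is rational over X_e = X_c ∪ X_d ∪ [X_c X_d]. -/
open scoped BigOperators

namespace QShuffleExt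

/-- The extended alphabet `X̄`: letters `x_A` are indexed by nonempty finite
multisets `A` of indices from `{0, 1, …, m}`; `x_i := x_{{i}}`. -/
abbrev Letter (m : ℕ) := {A : Multiset (Fin (m + 1)) // A ≠ 0}

/-- Words over the extended alphabet. -/
abbrev QWord (m : ℕ) := List (Letter m)

/-- Formal power series over `X̄`. -/
abbrev QSeries (m : ℕ) := QWord m → ℝ

noncomputable section

variable (m : ℕ)

/-- The commutative associative bracket `[x_A x_B] := x_{A ⊎ B}`. -/
def br (a b : Letter m) : Letter m :=
  ⟨a.1 + b.1, fun h => a.2 (by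
    have := congrArg Multiset.card h
    simp at this
    exact this.1)⟩

/-- Left catenation by a letter: `e ↦ a e`. -/
def cat (a : Letter m) (e : QSeries m) : QSeries m := fun ν =>
  match ν with
  | [] => 0
  | b :: ν' => if b = a then e ν' else 0

/-- The quasi-shuffle product of two words:
`(a v) ⊛ (b w) = a(v ⊛ (b w)) + b((a v) ⊛ w) − [a b](v ⊛ w)`,
`∅ ⊛ η = η ⊛ ∅ = η`. -/
def qshw : QWord m → QWord m → QSeries m
  | [], ξ => fun ν => if ν = ξ then 1 else 0
  | η, [] => fun ν => if ν = η then 1 else 0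
  | a :: v, b :: w =>
      cat m a (qshw v (b :: w)) + cat m b (qshw (a :: v) w)
        - cat m (br m a b) (qshw v w)
  termination_by v w => v.length + w.length

/-- The quasi-shuffle product, extended bilinearly to formal power series
(the extension is locally finite, hence well defined). -/
def qshS (c d : QSeries m) : QSeries m := fun ν =>
  ∑ᶠ p : QWord m × QWord m, c p.1 * d p.2 * qshw m p.1 p.2 ν

/-- The left-shift operator `a⁻¹` on series: `a⁻¹(c)(ν) = c(aν)`. -/
def leftShift (a : Letter m) (c : QSeries m) : QSeries m := fun ν => c (a :: ν)

/-- A subspace of series is stable when it is closed under all left shifts. -/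
def ShiftStable (V : Submodule ℝ (QSeries m)) : Prop :=
  ∀ a : Letter m, ∀ x ∈ V, leftShift m a x ∈ V

/-- `c` is a series over the finite sub-alphabet `X₀ ⊂ X̄`: its support only
contains words whose letters lie in `X₀`. -/
def SupportedOn (X₀ : Finset (Letter m)) (c : QSeries m) : Prop :=
  ∀ ν : QWord m, ¬ (∀ a ∈ ν, a ∈ X₀) → c ν = 0

/-- `c` is a rational series over the finite sub-alphabet `X₀ ⊂ X̄`: it is a
series over `X₀` lying in some finite-dimensional subspace stable under all
left shifts. -/
def IsRationalOn (X₀ : Finset (Letter m)) (c : QSeries m) : Prop :=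
  SupportedOn m X₀ c ∧
    ∃ V : Submodule ℝ (QSeries m),
      FiniteDimensional ℝ V ∧ ShiftStable m V ∧ c ∈ V

/-- The set of letters `[X_c X_d] = {[a b] : a ∈ X_c, b ∈ X_d}`. -/
def brSet (Xc Xd : Finset (Letter m)) : Finset (Letter m) :=
  (Xc ×ˢ Xd).image fun p => br m p.1 p.2

/-- Iterated sums over `X̄*`: `S_∅[û](N) = 1`,
`S_{x_A η}[û](N) = Σ_{k=1}^N (Π_{i∈A} û_i(k)) S_η[û](k)` (multiset product with
multiplicity). -/
def itS (u : ℕ → Fin (m + 1) → ℝ) : QWord m → ℕ → ℝ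
  | [], _ => 1
  | A :: η, N => ∑ k ∈ Finset.Icc 1 N, (A.1.map fun i => u k i).prod * itS u η k

section Auxiliary

variable {m : ℕ}

/-! ### The quasi-shuffle coefficients of a fixed word -/

theorem finite_br_fiber (a : Letter m) :
    {p : Letter m × Letter m | br m p.1 p.2 = a}.Finite := by
  have hinj : Function.Injective
      (fun p : Letter m × Letter m => ((p.1.1, p.2.1) : Multiset _ × Multiset _)) := by
    rintro ⟨b, b'⟩ ⟨e, e'⟩ h
    simp only [Prod.mk.injEq] at h
    exact Prod.ext (Subtype.ext h.1) (Subtype.ext h.2)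
  refine ((Multiset.finite_toSet a.1.antidiagonal).preimage hinj.injOn).subset ?_
  rintro ⟨b, b'⟩ h
  simpa [br, Subtype.ext_iff] using h

/-- The finite set of pairs of letters whose bracket is `a`. -/
def brFiber (a : Letter m) : Finset (Letter m × Letter m) := (finite_br_fiber a).toFinset

theorem mem_brFiber {a : Letter m} {p : Letter m × Letter m} :
    p ∈ brFiber a ↔ br m p.1 p.2 = a := by
  simp [brFiber]

/-- The finitely supported family `(η, ξ) ↦ (η ⊛ ξ, ν)`, by recursion on `ν`. -/
def unshuffle : QWord m → (QWord m × QWord m →₀ ℝ)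
  | [] => Finsupp.single ([], []) 1
  | a :: ν =>
      (unshuffle ν).mapDomain (Prod.map (List.cons a) id)
        + (unshuffle ν).mapDomain (Prod.map id (List.cons a))
        - ∑ q ∈ brFiber a, (unshuffle ν).mapDomain (Prod.map (List.cons q.1) (List.cons q.2))

theorem qshw_nil_right (η : QWord m) : qshw m η [] = fun ν => if ν = η then 1 else 0 := by
  cases η <;> simp [qshw]

theorem unshuffle_apply (ν η ξ : QWord m) : unshuffle ν (η, ξ) = qshw m η ξ ν := by
  have hL (a : Letter m) : Function.Injective (Prod.map (List.cons a) (id : QWord m → QWord m)) :=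
    (List.cons_injective).prodMap Function.injective_id
  have hR (a : Letter m) : Function.Injective (Prod.map (id : QWord m → QWord m) (List.cons a)) :=
    Function.injective_id.prodMap List.cons_injective
  have hB (a b : Letter m) : Function.Injective
      (Prod.map (List.cons a : QWord m → QWord m) (List.cons b : QWord m → QWord m)) :=
    List.cons_injective.prodMap List.cons_injective
  have left_cons (f : QWord m × QWord m →₀ ℝ) (a b : Letter m) (v ξ : QWord m) :
      f.mapDomain (Prod.map (List.cons a) id) (b :: v, ξ) = if b = a then f (v, ξ) else 0 := by
    split_ifs with h
    · subst h
      exact Finsupp.mapDomain_apply (hL b) f (v, ξ)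
    · refine Finsupp.mapDomain_of_notMem_range _ _ ?_
      rintro ⟨⟨x, y⟩, hxy⟩
      simp at hxy
      exact h hxy.1.1.symm
  have left_nil (f : QWord m × QWord m →₀ ℝ) (a : Letter m) (ξ : QWord m) :
      f.mapDomain (Prod.map (List.cons a) id) ([], ξ) = 0 := by
    refine Finsupp.mapDomain_of_notMem_range _ _ ?_
    rintro ⟨⟨x, y⟩, hxy⟩
    simp at hxy
  have right_cons (f : QWord m × QWord m →₀ ℝ) (a b : Letter m) (w η : QWord m) :
      f.mapDomain (Prod.map id (List.cons a)) (η, b :: w) = if b = a then f (η, w) else 0 := by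
    split_ifs with h
    · subst h
      exact Finsupp.mapDomain_apply (hR b) f (η, w)
    · refine Finsupp.mapDomain_of_notMem_range _ _ ?_
      rintro ⟨⟨x, y⟩, hxy⟩
      simp at hxy
      exact h hxy.2.1.symm
  have right_nil (f : QWord m × QWord m →₀ ℝ) (a : Letter m) (η : QWord m) :
      f.mapDomain (Prod.map id (List.cons a)) (η, []) = 0 := by
    refine Finsupp.mapDomain_of_notMem_range _ _ ?_
    rintro ⟨⟨x, y⟩, hxy⟩
    simp at hxy
  have both_nil_left (f : QWord m × QWord m →₀ ℝ) (a b : Letter m) (ξ : QWord m) :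
      f.mapDomain (Prod.map (List.cons a) (List.cons b)) ([], ξ) = 0 := by
    refine Finsupp.mapDomain_of_notMem_range _ _ ?_
    rintro ⟨⟨x, y⟩, hxy⟩
    simp at hxy
  have both_nil_right (f : QWord m × QWord m →₀ ℝ) (a b : Letter m) (η : QWord m) :
      f.mapDomain (Prod.map (List.cons a) (List.cons b)) (η, []) = 0 := by
    refine Finsupp.mapDomain_of_notMem_range _ _ ?_
    rintro ⟨⟨x, y⟩, hxy⟩
    simp at hxy
  have both_sum (f : QWord m × QWord m →₀ ℝ) (a b b' : Letter m) (v w : QWord m) :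
      ∑ q ∈ brFiber a, f.mapDomain (Prod.map (List.cons q.1) (List.cons q.2)) (b :: v, b' :: w)
        = if a = br m b b' then f (v, w) else 0 := by
    have off (q : Letter m × Letter m) (hq : q ≠ (b, b')) :
        f.mapDomain (Prod.map (List.cons q.1) (List.cons q.2)) (b :: v, b' :: w) = 0 := by
      refine Finsupp.mapDomain_of_notMem_range _ _ ?_
      rintro ⟨⟨x, y⟩, hxy⟩
      simp at hxy
      exact hq (Prod.ext hxy.1.1 hxy.2.1)
    split_ifs with h
    · rw [Finset.sum_eq_single (b, b') (fun q _ hq => off q hq)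
        (fun hn => absurd (mem_brFiber.2 h.symm) hn)]
      exact Finsupp.mapDomain_apply (hB b b') f (v, w)
    · refine Finset.sum_eq_zero fun q hq => off q ?_
      rintro rfl
      exact h (mem_brFiber.1 hq).symm
  induction ν generalizing η ξ with
  | nil =>
    rcases η with _ | ⟨b, v⟩ <;> rcases ξ with _ | ⟨b', w⟩ <;>
      simp [unshuffle, qshw, cat]
  | cons a ν ih =>
    rcases η with _ | ⟨b, v⟩ <;> rcases ξ with _ | ⟨b', w⟩
    · simp [unshuffle, qshw, left_nil, right_nil, both_nil_left]
    · simp only [unshuffle, qshw, left_nil, right_cons, both_nil_left, Finsupp.sub_apply,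
        Finsupp.add_apply, Finsupp.finsetSum_apply, ih, List.cons.injEq, ite_and,
        Finset.sum_const_zero, zero_add, sub_zero, eq_comm]
    · simp only [unshuffle, qshw_nil_right, left_cons, right_nil, both_nil_right,
        Finsupp.sub_apply, Finsupp.add_apply, Finsupp.finsetSum_apply, ih, List.cons.injEq,
        ite_and, Finset.sum_const_zero, add_zero, sub_zero, eq_comm]
    · simp only [unshuffle, qshw, left_cons, right_cons, both_sum, Finsupp.sub_apply,
        Finsupp.add_apply, Finsupp.finsetSum_apply, ih, cat, Pi.add_apply, Pi.sub_apply,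
        eq_comm]

theorem finite_support_qshS_term (c d : QSeries m) (ν : QWord m) :
    (Function.support fun p : QWord m × QWord m => c p.1 * d p.2 * qshw m p.1 p.2 ν).Finite := by
  refine (unshuffle ν).support.finite_toSet.subset fun p hp => ?_
  rw [Finset.mem_coe, Finsupp.mem_support_iff, unshuffle_apply ν p.1 p.2]
  exact right_ne_zero_of_mul hp

theorem qshS_eq_linearCombination (c d : QSeries m) (ν : QWord m) :
    qshS m c d ν
      = Finsupp.linearCombination ℝ (fun p : QWord m × QWord m => c p.1 * d p.2) (unshuffle ν) := by
  rw [qshS, Finsupp.linearCombination_apply, Finsupp.sum,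
    finsum_eq_sum_of_support_subset (s := (unshuffle ν).support)]
  · refine Finset.sum_congr rfl fun p _ => ?_
    rw [← unshuffle_apply, smul_eq_mul, mul_comm]
  · intro p hp
    rw [Finset.mem_coe, Finsupp.mem_support_iff, unshuffle_apply ν p.1 p.2]
    exact right_ne_zero_of_mul hp

/-! ### Rationality of the quasi-shuffle product -/

theorem qshS_cons (c d : QSeries m) (a : Letter m) (ν : QWord m) :
    qshS m c d (a :: ν) = qshS m (leftShift m a c) d ν + qshS m c (leftShift m a d) ν
      - ∑ q ∈ brFiber a, qshS m (leftShift m q.1 c) (leftShift m q.2 d) ν := by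
  simp only [qshS_eq_linearCombination, unshuffle, map_sub, map_add, map_sum,
    Finsupp.linearCombination_mapDomain]
  rfl

theorem leftShift_qshS (c d : QSeries m) (a : Letter m) :
    leftShift m a (qshS m c d) = qshS m (leftShift m a c) d + qshS m c (leftShift m a d)
      - ∑ q ∈ brFiber a, qshS m (leftShift m q.1 c) (leftShift m q.2 d) := by
  funext ν
  simp [leftShift, qshS_cons, Finset.sum_apply]

/-- The quasi-shuffle product of series as a bilinear map. -/
def qshBilin (m : ℕ) : QSeries m →ₗ[ℝ] QSeries m →ₗ[ℝ] QSeries m :=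
  LinearMap.mk₂ ℝ (qshS m)
    (fun c c' d => by
      funext ν
      simp only [qshS_eq_linearCombination, Finsupp.linearCombination_apply, Finsupp.sum,
        Pi.add_apply, ← Finset.sum_add_distrib, smul_eq_mul]
      exact Finset.sum_congr rfl fun _ _ => by ring)
    (fun r c d => by
      funext ν
      simp only [qshS_eq_linearCombination, Finsupp.linearCombination_apply, Finsupp.sum,
        Pi.smul_apply, Finset.mul_sum, smul_eq_mul]
      exact Finset.sum_congr rfl fun _ _ => by ring)
    (fun c d d' => by
      funext ν
      simp only [qshS_eq_linearCombination, Finsupp.linearCombination_apply, Finsupp.sum,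
        Pi.add_apply, ← Finset.sum_add_distrib, smul_eq_mul]
      exact Finset.sum_congr rfl fun _ _ => by ring)
    (fun r c d => by
      funext ν
      simp only [qshS_eq_linearCombination, Finsupp.linearCombination_apply, Finsupp.sum,
        Pi.smul_apply, Finset.mul_sum, smul_eq_mul]
      exact Finset.sum_congr rfl fun _ _ => by ring)

/-- The left shift as a linear map. -/
def shiftLin (a : Letter m) : QSeries m →ₗ[ℝ] QSeries m where
  toFun := leftShift m a
  map_add' _ _ := rfl
  map_smul' _ _ := rfl

theorem ShiftStable.map₂_qshBilin {V W : Submodule ℝ (QSeries m)} (hV : ShiftStable m V)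
    (hW : ShiftStable m W) : ShiftStable m (Submodule.map₂ (qshBilin m) V W) := by
  intro a
  suffices h : Submodule.map₂ (qshBilin m) V W
      ≤ (Submodule.map₂ (qshBilin m) V W).comap (shiftLin a) from h
  have mem {x y : QSeries m} (hx : x ∈ V) (hy : y ∈ W) :
      qshS m x y ∈ Submodule.map₂ (qshBilin m) V W :=
    Submodule.apply_mem_map₂ (qshBilin m) hx hy
  refine Submodule.map₂_le.2 fun x hx y hy => ?_
  change leftShift m a (qshS m x y) ∈ Submodule.map₂ (qshBilin m) V W
  rw [leftShift_qshS]
  exact sub_mem (add_mem (mem (hV a x hx) hy) (mem hx (hW a y hy)))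
    (sum_mem fun q _ => mem (hV q.1 x hx) (hW q.2 y hy))

theorem SupportedOn.leftShift {X : Finset (Letter m)} {c : QSeries m} (hc : SupportedOn m X c)
    (a : Letter m) : SupportedOn m X (leftShift m a c) := fun ν hν =>
  hc (a :: ν) fun h => hν fun b hb => h b (List.mem_cons_of_mem a hb)

theorem SupportedOn.leftShift_eq_zero {X : Finset (Letter m)} {c : QSeries m}
    (hc : SupportedOn m X c) {a : Letter m} (ha : a ∉ X) : QShuffleExt.leftShift m a c = 0 :=
  funext fun ν => hc (a :: ν) fun h => ha (h a List.mem_cons_self)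

theorem qshS_zero_left (d : QSeries m) : qshS m 0 d = 0 := (qshBilin m).map_zero₂ d

theorem qshS_zero_right (c : QSeries m) : qshS m c 0 = 0 := (qshBilin m c).map_zero

theorem SupportedOn.qshS {Xc Xd : Finset (Letter m)} {c d : QSeries m}
    (hc : SupportedOn m Xc c) (hd : SupportedOn m Xd d) :
    SupportedOn m (Xc ∪ Xd ∪ brSet m Xc Xd) (qshS m c d) := by
  intro ν hν
  induction ν generalizing c d with
  | nil => simp at hν
  | cons a ν ih =>
    rw [qshS_cons]
    by_cases ha : a ∈ Xc ∪ Xd ∪ brSet m Xc Xd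
    · have hν' : ¬ ∀ b ∈ ν, b ∈ Xc ∪ Xd ∪ brSet m Xc Xd := fun h =>
        hν (List.forall_mem_cons.2 ⟨ha, h⟩)
      rw [ih (hc.leftShift a) hd hν', ih hc (hd.leftShift a) hν',
        Finset.sum_eq_zero fun q _ => ih (hc.leftShift q.1) (hd.leftShift q.2) hν']
      simp
    · simp only [Finset.mem_union, not_or] at ha
      have hsum : ∀ q ∈ brFiber a,
          QShuffleExt.qshS m (QShuffleExt.leftShift m q.1 c)
            (QShuffleExt.leftShift m q.2 d) ν = 0 := by
        intro q hq
        by_cases h1 : q.1 ∈ Xc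
        · have h2 : q.2 ∉ Xd := fun h2 => ha.2 (Finset.mem_image.2
            ⟨q, Finset.mem_product.2 ⟨h1, h2⟩, mem_brFiber.1 hq⟩)
          rw [hd.leftShift_eq_zero h2, qshS_zero_right]
          rfl
        · rw [hc.leftShift_eq_zero h1, qshS_zero_left]
          rfl
      rw [Finset.sum_eq_zero hsum, hc.leftShift_eq_zero ha.1.1, hd.leftShift_eq_zero ha.1.2,
        qshS_zero_left, qshS_zero_right]
      simp

theorem IsRationalOn.qshS {Xc Xd : Finset (Letter m)} {c d : QSeries m}
    (hc : IsRationalOn m Xc c) (hd : IsRationalOn m Xd d) :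
    IsRationalOn m (Xc ∪ Xd ∪ brSet m Xc Xd) (qshS m c d) := by
  obtain ⟨hcX, V, hVfin, hV, hcV⟩ := hc
  obtain ⟨hdX, W, hWfin, hW, hdW⟩ := hd
  refine ⟨hcX.qshS hdX, Submodule.map₂ (qshBilin m) V W, ?_, hV.map₂_qshBilin hW,
    Submodule.apply_mem_map₂ (qshBilin m) hcV hdW⟩
  exact Module.Finite.iff_fg.2
    ((Module.Finite.iff_fg.1 hVfin).map₂ _ (Module.Finite.iff_fg.1 hWfin))

/-! ### Growth of rational series -/

theorem IsRationalOn.exists_growth {X : Finset (Letter m)} {c : QSeries m}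
    (hc : IsRationalOn m X c) :
    ∃ K M : ℝ, 0 ≤ K ∧ 0 ≤ M ∧ ∀ ν : QWord m, |c ν| ≤ K * M ^ ν.length := by
  obtain ⟨hcX, V, hVfin, hV, hcV⟩ := hc
  let φ := (Module.finBasis ℝ V).equivFun
  let S (a : Letter m) : V →ₗ[ℝ] V := (shiftLin a).restrict (hV a)
  let T (a : Letter m) := (φ.toLinearMap ∘ₗ S a ∘ₗ φ.symm.toLinearMap).toContinuousLinearMap
  let ε := ((LinearMap.proj ([] : QWord m) : QSeries m →ₗ[ℝ] ℝ) ∘ₗ V.subtype ∘ₗ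
    φ.symm.toLinearMap).toContinuousLinearMap
  let M : ℝ := ∑ a ∈ X, ‖T a‖
  have hM : 0 ≤ M := Finset.sum_nonneg fun _ _ => norm_nonneg _
  have key : ∀ ν : QWord m, (∀ a ∈ ν, a ∈ X) → ∀ x : V,
      |(x : QSeries m) ν| ≤ ‖ε‖ * ‖φ x‖ * M ^ ν.length := by
    intro ν
    induction ν with
    | nil =>
      intro _ x
      have h := ε.le_opNorm (φ x)
      have he : ε (φ x) = (x : QSeries m) [] := by simp [ε]
      rw [he] at h
      simpa using h
    | cons a ν ih =>
      intro hν x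
      obtain ⟨ha, hν⟩ := List.forall_mem_cons.1 hν
      have h1 := ih hν (S a x)
      have h2 : ‖φ (S a x)‖ ≤ M * ‖φ x‖ := by
        have h := (T a).le_opNorm (φ x)
        have he : T a (φ x) = φ (S a x) := by simp [T]
        rw [he] at h
        refine h.trans (mul_le_mul_of_nonneg_right ?_ (norm_nonneg _))
        exact Finset.single_le_sum (f := fun a => ‖T a‖) (fun _ _ => norm_nonneg _) ha
      calc |(x : QSeries m) (a :: ν)| ≤ ‖ε‖ * ‖φ (S a x)‖ * M ^ ν.length := h1
        _ ≤ ‖ε‖ * (M * ‖φ x‖) * M ^ ν.length := by gcongr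
        _ = ‖ε‖ * ‖φ x‖ * M ^ (a :: ν).length := by rw [List.length_cons, pow_succ]; ring
  refine ⟨‖ε‖ * ‖φ ⟨c, hcV⟩‖, M, by positivity, hM, fun ν => ?_⟩
  by_cases hν : ∀ a ∈ ν, a ∈ X
  · exact key ν hν ⟨c, hcV⟩
  · rw [hcX ν hν, abs_zero]
    positivity

theorem summable_pow_length {α : Type*} [Fintype α] {r : ℝ} (hr : 0 ≤ r)
    (h : Fintype.card α * r < 1) : Summable fun l : List α => r ^ l.length := by
  rw [← (Equiv.sigmaFiberEquiv (List.length : List α → ℕ)).summable_iff]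
  have hfin (n : ℕ) : Fintype {l : List α // l.length = n} :=
    inferInstanceAs (Fintype (List.Vector α n))
  refine (summable_sigma_of_nonneg fun _ => by
    simp only [Function.comp_apply]; positivity).2 ⟨fun n => ?_, ?_⟩
  · exact (hasSum_fintype _).summable
  · refine (summable_geometric_of_lt_one (by positivity) h).congr fun n => ?_
    have hconst (l : {l : List α // l.length = n}) :
        ((fun l : List α => r ^ l.length) ∘
          Equiv.sigmaFiberEquiv (List.length : List α → ℕ)) ⟨n, l⟩ = r ^ n := by
      simp [l.2]
    simp only [hconst, tsum_fintype, Finset.sum_const, nsmul_eq_mul, Finset.card_univ, mul_pow]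
    congr 1
    rw [← Nat.cast_pow, ← card_vector n]
    exact congrArg _ (Fintype.card_congr (Equiv.refl _))

theorem IsRationalOn.exists_summable {X : Finset (Letter m)} {c : QSeries m}
    (hc : IsRationalOn m X c) :
    ∃ ρ : ℝ, 0 < ρ ∧ ∀ r : ℝ, 0 ≤ r → r ≤ ρ → Summable fun η : QWord m => |c η| * r ^ η.length := by
  obtain ⟨K, M, hK, hM, hKM⟩ := hc.exists_growth
  refine ⟨1 / (M * X.card + 1), by positivity, fun r hr hrρ => ?_⟩
  have hlt : Fintype.card X * (M * r) < 1 := by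
    rw [le_div_iff₀ (by positivity)] at hrρ
    rw [Fintype.card_coe]
    rcases hr.eq_or_lt with rfl | hr
    · simp
    · nlinarith
  rw [← (List.map_injective_iff.2 (Subtype.val_injective (p := (· ∈ X)))).summable_iff]
  · refine Summable.of_nonneg_of_le (fun l => by simp only [Function.comp_apply]; positivity)
      (fun l => ?_) ((summable_pow_length (by positivity) hlt).mul_left K)
    have h := mul_le_mul_of_nonneg_right (hKM (l.map Subtype.val))
      (pow_nonneg hr l.length)
    simpa [mul_pow, mul_assoc] using h
  · intro η hη
    have : c η = 0 := hc.1 η fun h => hη (by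
      rw [Set.range_list_map_coe]
      exact h)
    simp [this]

/-! ### Iterated sums -/

/-- The value of the letter `a` on the input sample `x`. -/
abbrev letterVal (x : Fin (m + 1) → ℝ) (a : Letter m) : ℝ := (a.1.map fun i => x i).prod

theorem letterVal_br (x : Fin (m + 1) → ℝ) (a b : Letter m) :
    letterVal x (br m a b) = letterVal x a * letterVal x b := by
  simp [letterVal, br]

theorem abs_letterVal_le {R : ℝ} (hR1 : R ≤ 1) {x : Fin (m + 1) → ℝ}
    (hx : ∀ i, |x i| ≤ R) (a : Letter m) : |letterVal x a| ≤ R := by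
  have hR0 : 0 ≤ R := (abs_nonneg _).trans (hx 0)
  have key (A : Multiset (Fin (m + 1))) : |(A.map fun i => x i).prod| ≤ R ^ A.card := by
    induction A using Multiset.induction_on with
    | empty => simp
    | cons i A ih =>
      rw [Multiset.map_cons, Multiset.prod_cons, abs_mul, Multiset.card_cons, pow_succ']
      exact mul_le_mul (hx i) ih (abs_nonneg _) hR0
  exact (key a.1).trans (pow_le_of_le_one hR0 hR1 (mt Multiset.card_eq_zero.1 a.2))

theorem sum_Icc_two_pow_le (N : ℕ) : ∑ k ∈ Finset.Icc 1 N, (2 : ℝ) ^ k ≤ 2 * 2 ^ N := by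
  induction N with
  | zero => simp
  | succ N ih =>
    rw [Finset.sum_Icc_succ_top (by omega), pow_succ]
    linarith

theorem hasSum_cat_mul {a : Letter m} {e g : QSeries m} {s : ℝ} :
    HasSum (fun ν => cat m a e ν * g ν) s ↔ HasSum (fun ν => e ν * g (a :: ν)) s := by
  rw [← (List.cons_injective (a := a)).hasSum_iff]
  · simp [Function.comp_def, cat]
  · rintro (_ | ⟨b, ν⟩) h
    · simp [cat]
    · have : b ≠ a := by
        rintro rfl
        exact h ⟨ν, rfl⟩
      simp [cat, this]

section Input

variable (u : ℕ → Fin (m + 1) → ℝ)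

theorem itS_cons (a : Letter m) (η : QWord m) (N : ℕ) :
    itS m u (a :: η) N = ∑ k ∈ Finset.Icc 1 N, letterVal (u k) a * itS m u η k := by
  rw [itS]

theorem hasSum_cat_itS {e : QSeries m} {s : ℕ → ℝ}
    (h : ∀ k, HasSum (fun ν => e ν * itS m u ν k) (s k)) (a : Letter m) (N : ℕ) :
    HasSum (fun ν => cat m a e ν * itS m u ν N)
      (∑ k ∈ Finset.Icc 1 N, letterVal (u k) a * s k) := by
  rw [hasSum_cat_mul]
  refine (hasSum_sum fun k _ => (h k).mul_left (letterVal (u k) a)).congr_fun fun ν => ?_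
  rw [itS_cons, Finset.mul_sum]
  exact Finset.sum_congr rfl fun k _ => by ring

theorem sum_mul_sum_Icc (f g : ℕ → ℝ) (N : ℕ) :
    (∑ k ∈ Finset.Icc 1 N, f k) * (∑ k ∈ Finset.Icc 1 N, g k)
      = ∑ k ∈ Finset.Icc 1 N, f k * ∑ j ∈ Finset.Icc 1 k, g j
        + ∑ k ∈ Finset.Icc 1 N, g k * ∑ j ∈ Finset.Icc 1 k, f j
        - ∑ k ∈ Finset.Icc 1 N, f k * g k := by
  induction N with
  | zero => simp
  | succ N ih =>
    simp only [Finset.sum_Icc_succ_top (show 1 ≤ N + 1 by omega)] at ih ⊢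
    linear_combination ih

theorem hasSum_qshw_itS (η ξ : QWord m) (N : ℕ) :
    HasSum (fun ν => qshw m η ξ ν * itS m u ν N) (itS m u η N * itS m u ξ N) := by
  have single (η : QWord m) (N : ℕ) :
      HasSum (fun ν => (if ν = η then 1 else 0) * itS m u ν N) (itS m u η N) := by
    refine (hasSum_ite_eq η (itS m u η N)).congr_fun fun ν => ?_
    split_ifs with h <;> simp [h]
  match η, ξ with
  | [], ξ => simpa [qshw, itS] using single ξ N
  | a :: v, [] => simpa [qshw, itS] using single (a :: v) N
  | a :: v, b :: w =>
    have h := ((hasSum_cat_itS u (hasSum_qshw_itS v (b :: w)) a N).add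
      (hasSum_cat_itS u (hasSum_qshw_itS (a :: v) w) b N)).sub
      (hasSum_cat_itS u (hasSum_qshw_itS v w) (br m a b) N)
    have hval : itS m u (a :: v) N * itS m u (b :: w) N
        = ∑ k ∈ Finset.Icc 1 N, letterVal (u k) a * (itS m u v k * itS m u (b :: w) k)
          + ∑ k ∈ Finset.Icc 1 N, letterVal (u k) b * (itS m u (a :: v) k * itS m u w k)
          - ∑ k ∈ Finset.Icc 1 N, letterVal (u k) (br m a b) * (itS m u v k * itS m u w k) := by
      rw [itS_cons, itS_cons, sum_mul_sum_Icc]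
      simp only [itS_cons, letterVal_br]
      congr 1
      · congr 1 <;> exact Finset.sum_congr rfl fun k _ => by ring
      · exact Finset.sum_congr rfl fun k _ => by ring
    rw [hval]
    refine h.congr_fun fun ν => ?_
    simp only [qshw, Pi.add_apply, Pi.sub_apply]
    ring
  termination_by η.length + ξ.length

variable {u} {R : ℝ}

theorem sum_two_pow_bound {f : ℕ → ℝ} {B : ℝ} (hB : 0 ≤ B) {N : ℕ}
    (hf : ∀ k ∈ Finset.Icc 1 N, f k ≤ 2 ^ k * B) :
    ∑ k ∈ Finset.Icc 1 N, f k ≤ 2 ^ N * (2 * B) := by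
  calc ∑ k ∈ Finset.Icc 1 N, f k ≤ ∑ k ∈ Finset.Icc 1 N, 2 ^ k * B := Finset.sum_le_sum hf
    _ = (∑ k ∈ Finset.Icc 1 N, (2 : ℝ) ^ k) * B := by rw [Finset.sum_mul]
    _ ≤ 2 * 2 ^ N * B := mul_le_mul_of_nonneg_right (sum_Icc_two_pow_le N) hB
    _ = 2 ^ N * (2 * B) := by ring

theorem abs_itS_le (hR0 : 0 ≤ R) (hR1 : R ≤ 1) (hu : ∀ N, 1 ≤ N → ∀ i, |u N i| ≤ R)
    (η : QWord m) (N : ℕ) : |itS m u η N| ≤ 2 ^ N * (5 * R) ^ η.length := by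
  induction η generalizing N with
  | nil => simpa [itS] using one_le_pow₀ (M₀ := ℝ) one_le_two
  | cons a η ih =>
    rw [itS_cons]
    have hB : 0 ≤ R * (5 * R) ^ η.length := by positivity
    have h := sum_two_pow_bound (N := N)
      (f := fun k => |letterVal (u k) a * itS m u η k|) hB fun k hk => by
        rw [abs_mul]
        calc _ ≤ R * (2 ^ k * (5 * R) ^ η.length) :=
              mul_le_mul (abs_letterVal_le hR1 (hu k (Finset.mem_Icc.1 hk).1) a) (ih k)
                (abs_nonneg _) hR0
          _ = _ := by ring
    refine (Finset.abs_sum_le_sum_abs _ _).trans (h.trans ?_)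
    rw [List.length_cons, pow_succ]
    have := mul_nonneg (pow_nonneg (zero_le_two (α := ℝ)) N) hB
    linarith

/-- Absolute summability of a series against all iterated sums, with a bound growing like `2 ^ N`. -/
def AbsBound (u : ℕ → Fin (m + 1) → ℝ) (e : QSeries m) (B : ℝ) : Prop :=
  ∀ N, ∃ s, s ≤ 2 ^ N * B ∧ HasSum (fun ν => |e ν| * |itS m u ν N|) s

theorem AbsBound.of_le {e : QSeries m} {g : ℕ → QSeries m} {B : ℝ}
    (hle : ∀ N ν, |e ν| * |itS m u ν N| ≤ g N ν)
    (hg : ∀ N, ∃ s, s ≤ 2 ^ N * B ∧ HasSum (g N) s) : AbsBound u e B := by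
  intro N
  obtain ⟨s, hs, hsum⟩ := hg N
  have hS : Summable fun ν => |e ν| * |itS m u ν N| :=
    Summable.of_nonneg_of_le (fun _ => by positivity) (hle N) hsum.summable
  exact ⟨_, (hasSum_le (hle N) hS.hasSum hsum).trans hs, hS.hasSum⟩

theorem AbsBound.cat {e : QSeries m} {B Q : ℝ} (he : AbsBound u e B) (hB : 0 ≤ B) (hQ : 0 ≤ Q)
    {a : Letter m} (ha : ∀ k, 1 ≤ k → |letterVal (u k) a| ≤ Q) :
    AbsBound u (cat m a e) (2 * (Q * B)) := by
  intro N
  choose s hs hsum using he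
  have habs : (fun ν => |QShuffleExt.cat m a e ν| * |itS m u ν N|)
      = fun ν => QShuffleExt.cat m a (fun ν => |e ν|) ν * |itS m u ν N| := by
    funext ν
    rcases ν with _ | ⟨b, ν⟩
    · simp [QShuffleExt.cat]
    · by_cases h : b = a <;> simp [QShuffleExt.cat, h]
  have hmaj : HasSum (fun ν => ∑ k ∈ Finset.Icc 1 N, Q * (|e ν| * |itS m u ν k|))
      (∑ k ∈ Finset.Icc 1 N, Q * s k) := hasSum_sum fun k _ => (hsum k).mul_left Q
  have hle (ν : QWord m) : |e ν| * |itS m u (a :: ν) N|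
      ≤ ∑ k ∈ Finset.Icc 1 N, Q * (|e ν| * |itS m u ν k|) := by
    rw [itS_cons]
    calc _ ≤ |e ν| * ∑ k ∈ Finset.Icc 1 N, |letterVal (u k) a * itS m u ν k| := by
          gcongr
          exact Finset.abs_sum_le_sum_abs _ _
      _ = ∑ k ∈ Finset.Icc 1 N, |letterVal (u k) a| * (|e ν| * |itS m u ν k|) := by
          rw [Finset.mul_sum]
          exact Finset.sum_congr rfl fun k _ => by rw [abs_mul]; ring
      _ ≤ _ := Finset.sum_le_sum fun k hk =>
          mul_le_mul_of_nonneg_right (ha k (Finset.mem_Icc.1 hk).1) (by positivity)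
  have hS : Summable fun ν => |e ν| * |itS m u (a :: ν) N| :=
    Summable.of_nonneg_of_le (fun _ => by positivity) hle hmaj.summable
  refine ⟨∑' ν, |e ν| * |itS m u (a :: ν) N|, ?_, ?_⟩
  · refine (hasSum_le hle hS.hasSum hmaj).trans ?_
    refine sum_two_pow_bound (by positivity) fun k _ => ?_
    calc Q * s k ≤ Q * (2 ^ k * B) := mul_le_mul_of_nonneg_left (hs k) hQ
      _ = _ := by ring
  · rw [habs]
    exact (hasSum_cat_mul (e := fun ν => |e ν|) (g := fun ν => |itS m u ν N|)).2 hS.hasSum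

theorem absBound_qshw (hR0 : 0 ≤ R) (hR1 : R ≤ 1) (hu : ∀ N, 1 ≤ N → ∀ i, |u N i| ≤ R)
    (η ξ : QWord m) : AbsBound u (qshw m η ξ) ((5 * R) ^ (η.length + ξ.length)) := by
  have single (η : QWord m) :
      AbsBound u (fun ν => if ν = η then 1 else 0) ((5 * R) ^ η.length) := fun N =>
    ⟨|itS m u η N|, abs_itS_le hR0 hR1 hu η N, by
      convert hasSum_ite_eq η |itS m u η N| using 2 with ν
      split_ifs with h <;> simp [h]⟩
  match η, ξ with
  | [], ξ => simpa [qshw] using single ξ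
  | a :: v, [] => simpa [qshw] using single (a :: v)
  | a :: v, b :: w =>
    have hval (k : ℕ) (hk : 1 ≤ k) (e : Letter m) : |letterVal (u k) e| ≤ R :=
      abs_letterVal_le hR1 (hu k hk) e
    have h1 := (absBound_qshw hR0 hR1 hu v (b :: w)).cat (by positivity) hR0
      (a := a) fun k hk => hval k hk a
    have h2 := (absBound_qshw hR0 hR1 hu (a :: v) w).cat (by positivity) hR0
      (a := b) fun k hk => hval k hk b
    have h3 := (absBound_qshw hR0 hR1 hu v w).cat (by positivity) (mul_nonneg hR0 hR0)
      (a := br m a b) fun k hk => by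
        rw [letterVal_br, abs_mul]
        exact mul_le_mul (hval k hk a) (hval k hk b) (abs_nonneg _) hR0
    choose s₁ hs₁ hsum₁ using h1
    choose s₂ hs₂ hsum₂ using h2
    choose s₃ hs₃ hsum₃ using h3
    refine AbsBound.of_le (fun N ν => ?_) fun N =>
      ⟨_, ?_, ((hsum₁ N).add (hsum₂ N)).add (hsum₃ N)⟩
    · rw [← add_mul, ← add_mul]
      refine mul_le_mul_of_nonneg_right ?_ (abs_nonneg _)
      rw [qshw]
      exact (abs_sub _ _).trans (add_le_add_left (abs_add_le _ _) _)
    · refine (add_le_add (add_le_add (hs₁ N) (hs₂ N)) (hs₃ N)).trans ?_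
      have hpos : 0 ≤ 2 ^ N * (R * R * (5 * R) ^ (v.length + w.length)) := by positivity
      have e1 : v.length + (b :: w).length = v.length + w.length + 1 := by simp; omega
      have e2 : (a :: v).length + w.length = v.length + w.length + 1 := by simp; omega
      have e3 : (a :: v).length + (b :: w).length = v.length + w.length + 2 := by simp; omega
      rw [e1, e2, e3, pow_add _ _ 2, pow_succ]
      linarith
  termination_by η.length + ξ.length

end Input

/-! ### The product of Fliess operators -/

theorem summable_abs_mul_itS {R : ℝ} (hR0 : 0 ≤ R) (hR1 : R ≤ 1) {u : ℕ → Fin (m + 1) → ℝ}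
    (hu : ∀ N, 1 ≤ N → ∀ i, |u N i| ≤ R) {c : QSeries m}
    (hc : Summable fun η : QWord m => |c η| * (5 * R) ^ η.length) (N : ℕ) :
    Summable fun η : QWord m => |c η * itS m u η N| := by
  refine Summable.of_nonneg_of_le (fun _ => abs_nonneg _) (fun η => ?_) (hc.mul_left (2 ^ N))
  rw [abs_mul]
  calc _ ≤ |c η| * (2 ^ N * (5 * R) ^ η.length) :=
        mul_le_mul_of_nonneg_left (abs_itS_le hR0 hR1 hu η N) (abs_nonneg _)
    _ = _ := by ring

theorem summable_qshw_triple {R : ℝ} (hR0 : 0 ≤ R) (hR1 : R ≤ 1) {u : ℕ → Fin (m + 1) → ℝ}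
    (hu : ∀ N, 1 ≤ N → ∀ i, |u N i| ≤ R) {c d : QSeries m}
    (hc : Summable fun η : QWord m => |c η| * (5 * R) ^ η.length)
    (hd : Summable fun η : QWord m => |d η| * (5 * R) ^ η.length) (N : ℕ) :
    Summable fun q : (QWord m × QWord m) × QWord m =>
      c q.1.1 * d q.1.2 * qshw m q.1.1 q.1.2 q.2 * itS m u q.2 N := by
  choose s hs hsum using fun p : QWord m × QWord m => absBound_qshw hR0 hR1 hu p.1 p.2 N
  have hfib (p : QWord m × QWord m) : HasSum (fun ν =>
      |c p.1 * d p.2 * qshw m p.1 p.2 ν * itS m u ν N|) (|c p.1 * d p.2| * s p) := by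
    refine ((hsum p).mul_left |c p.1 * d p.2|).congr_fun fun ν => ?_
    rw [abs_mul, abs_mul _ (qshw m p.1 p.2 ν), mul_assoc]
  refine summable_abs_iff.1 ((summable_prod_of_nonneg fun _ => abs_nonneg _).2
    ⟨fun p => (hfib p).summable, ?_⟩)
  refine Summable.of_nonneg_of_le (fun p => tsum_nonneg fun _ => abs_nonneg _) (fun p => ?_)
    ((hc.mul_of_nonneg hd (fun _ => by positivity) fun _ => by positivity).mul_left (2 ^ N))
  rw [(hfib p).tsum_eq]
  calc _ ≤ |c p.1 * d p.2| * (2 ^ N * (5 * R) ^ (p.1.length + p.2.length)) :=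
        mul_le_mul_of_nonneg_left (hs p) (abs_nonneg _)
    _ = _ := by rw [abs_mul, pow_add]; ring

theorem qshS_mul_itS_eq_tsum (u : ℕ → Fin (m + 1) → ℝ) (c d : QSeries m) (ν : QWord m) (N : ℕ) :
    qshS m c d ν * itS m u ν N
      = ∑' p : QWord m × QWord m, c p.1 * d p.2 * qshw m p.1 p.2 ν * itS m u ν N := by
  rw [tsum_mul_right, tsum_eq_finsum (finite_support_qshS_term c d ν), qshS]

end Auxiliary

/-- If `c` and `d` are rational over finite sub-alphabets `X_c`
and `X_d` of `X̄`, then there is an `R̂ > 0` such that for every input bounded by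
`R̂` the series defining `F̂_c[û](N)`, `F̂_d[û](N)` and `F̂_{c⊛d}[û](N)` converge
absolutely for all `N ≥ 1` and `F̂_c[û](N) F̂_d[û](N) = F̂_{c⊛d}[û](N)`; moreover
`e = c ⊛ d` is rational over `X_e = X_c ∪ X_d ∪ [X_c X_d]`. -/
theorem rational_parallel_product (m : ℕ) (Xc Xd : Finset (Letter m))
    (c d : QSeries m) (hc : IsRationalOn m Xc c) (hd : IsRationalOn m Xd d) :
    (∃ R : ℝ, 0 < R ∧ ∀ u : ℕ → Fin (m + 1) → ℝ,
      (∀ N, 1 ≤ N → ∀ i, |u N i| ≤ R) → ∀ N : ℕ, 1 ≤ N →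
        Summable (fun η : QWord m => |c η * itS m u η N|) ∧
        Summable (fun η : QWord m => |d η * itS m u η N|) ∧
        Summable (fun η : QWord m => |qshS m c d η * itS m u η N|) ∧
        (∑' η : QWord m, c η * itS m u η N) * (∑' η : QWord m, d η * itS m u η N)
          = ∑' η : QWord m, qshS m c d η * itS m u η N) ∧
    IsRationalOn m (Xc ∪ Xd ∪ brSet m Xc Xd) (qshS m c d) := by
  refine ⟨?_, hc.qshS hd⟩
  obtain ⟨ρc, hρc, hsc⟩ := hc.exists_summable
  obtain ⟨ρd, hρd, hsd⟩ := hd.exists_summable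
  obtain ⟨R, hR0, hR⟩ : ∃ R : ℝ, 0 < R ∧ 5 * R = min (min ρc ρd) 1 :=
    ⟨min (min ρc ρd) 1 / 5, by positivity, by ring⟩
  have hR1 : R ≤ 1 := by linarith [min_le_right (min ρc ρd) 1]
  have hRcd : 5 * R ≤ min ρc ρd := hR.trans_le (min_le_left _ _)
  have hc' := hsc (5 * R) (by positivity) (hRcd.trans (min_le_left _ _))
  have hd' := hsd (5 * R) (by positivity) (hRcd.trans (min_le_right _ _))
  refine ⟨R, hR0, fun u hu N _ => ?_⟩
  have hcS := summable_abs_mul_itS hR0.le hR1 hu hc' N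
  have hdS := summable_abs_mul_itS hR0.le hR1 hu hd' N
  have hF := summable_qshw_triple hR0.le hR1 hu hc' hd' N
  refine ⟨hcS, hdS, ?_, ?_⟩
  · refine summable_abs_iff.2 (hF.prod_symm.prod.congr fun ν => ?_)
    exact (qshS_mul_itS_eq_tsum u c d ν N).symm
  · have hinner (p : QWord m × QWord m) :
        ∑' ν, c p.1 * d p.2 * qshw m p.1 p.2 ν * itS m u ν N
          = c p.1 * itS m u p.1 N * (d p.2 * itS m u p.2 N) := by
      rw [mul_mul_mul_comm, ← (hasSum_qshw_itS u p.1 p.2 N).tsum_eq, ← tsum_mul_left]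
      exact tsum_congr fun ν => mul_assoc _ _ _
    rw [tsum_mul_tsum_of_summable_norm (f := fun η => c η * itS m u η N)
      (g := fun η => d η * itS m u η N) hcS hdS]
    simp only [qshS_mul_itS_eq_tsum, ← hinner]
    exact hF.tsum_comm.symm

end

end QShuffleExt
end

section
/- The mixed composition product satisfies mixed associativity: for all c ∈ ℝ^ℓ⟨⟨X⟩⟩ and d, e ∈ ℝ^m⟨⟨X⟩⟩, (c ∘̃ d) ∘̃ e = c ∘̃ (e + d ∘̃ e). Consequently the group product c_δ ∘ d_δ := δ + d + c ∘̃ d on ℝ^m⟨⟨X_δ⟩⟩ is associative. -/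
/-!
STATEMENT 0: The set ℝ^m⟨⟨X_δ⟩⟩ forms a group under the composition product;
equivalently, c ⊚ d := d + c ∘̃ d on ℝ^m⟨⟨X⟩⟩ is associative, has 0 as a two-sided
identity, and every c has a two-sided inverse.
-/

open scoped BigOperators

namespace FliessStmt

/-- Words over the alphabet `X = {x_0, …, x_m}`. -/
abbrev Word (m : ℕ) := List (Fin (m + 1))

/-- Formal power series over `X`: coefficient functions on words. -/
abbrev Series (m : ℕ) := Word m → ℝ

noncomputable section

variable (m : ℕ)

/-- The series `1 = 1∅`. -/
def one : Series m := fun ν => if ν = [] then 1 else 0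

/-- Left catenation by the letter `x_i`:  `e ↦ x_i e`. -/
def cat (i : Fin (m + 1)) (e : Series m) : Series m := fun ν =>
  match ν with
  | [] => 0
  | j :: ν' => if j = i then e ν' else 0

/-- The shuffle product of two words, as a formal power series (a polynomial):
`(x_i η) ⧢ (x_j ξ) = x_i(η ⧢ (x_j ξ)) + x_j((x_i η) ⧢ ξ)`, `∅ ⧢ η = η ⧢ ∅ = η`. -/
def shw : Word m → Word m → Series m
  | [], ξ => fun ν => if ν = ξ then 1 else 0
  | η, [] => fun ν => if ν = η then 1 else 0
  | i :: η, j :: ξ => cat m i (shw η (j :: ξ)) + cat m j (shw (i :: η) ξ)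
  termination_by η ξ => η.length + ξ.length

/-- The shuffle product, extended bilinearly to formal power series. -/
def sh (c d : Series m) : Series m := fun ν =>
  ∑ᶠ p : Word m × Word m, c p.1 * d p.2 * shw m p.1 p.2 ν

/-- For `d ∈ ℝ^m⟨⟨X⟩⟩`, the component `d_i` with the convention `d_0 := 0`. -/
def dsel (d : Fin m → Series m) (i : Fin (m + 1)) : Series m :=
  if h : i = 0 then 0 else d (i.pred h)

/-- `φ_d(x_i)(e) = x_i e + x_0 (d_i ⧢ e)`. -/
def phiStep (d : Fin m → Series m) (i : Fin (m + 1)) (e : Series m) : Series m :=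
  cat m i e + cat m 0 (sh m (dsel m d i) e)

/-- The homomorphism `φ_d` on words, `φ_d(∅) = id`, `φ_d(x_i η) = φ_d(x_i) ∘ φ_d(η)`. -/
def phi (d : Fin m → Series m) : Word m → Series m → Series m
  | [], e => e
  | i :: η, e => phiStep m d i (phi d η e)

/-- The modified composition product `c ∘̃ d = Σ_η (c,η) φ_d(η)(1)`
(the sum is locally finite, hence given coefficientwise by a finite sum). -/
def modcomp (c : Series m) (d : Fin m → Series m) : Series m := fun ν =>
  ∑ᶠ η : Word m, c η * phi m d η (one m) ν

/-- The modified composition product, componentwise for vector-valued `c`. -/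
def modcompV {ℓ : ℕ} (c : Fin ℓ → Series m) (d : Fin m → Series m) : Fin ℓ → Series m :=
  fun j => modcomp m (c j) d

/-- The group product `c ⊚ d := d + c ∘̃ d` on `ℝ^m⟨⟨X⟩⟩`
(so that `c_δ ∘ d_δ = δ + c ⊚ d`). -/
def gprod (c d : Fin m → Series m) : Fin m → Series m :=
  d + modcompV m c d


section Auxiliary

variable {m : ℕ}

/-- The left shift `x_i⁻¹ c`, whose coefficients are `ν ↦ (c, x_i ν)`. -/
def shift (i : Fin (m + 1)) (c : Series m) : Series m := fun ν => c (i :: ν)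

/-- Two series agree on all words of length at most `n`. -/
def AgreeUpTo (n : ℕ) (c d : Series m) : Prop := ∀ ν : Word m, ν.length ≤ n → c ν = d ν

theorem shift_add (i : Fin (m + 1)) (c d : Series m) :
    shift i (c + d) = shift i c + shift i d := rfl

theorem AgreeUpTo.of_shift {n : ℕ} {c d : Series m} (h0 : c [] = d [])
    (hs : ∀ k, ∀ n' < n, AgreeUpTo n' (shift k c) (shift k d)) : AgreeUpTo n c d := by
  rintro (_ | ⟨k, ν⟩) hν
  · exact h0
  · exact hs k ν.length (by simpa using hν) ν le_rfl

theorem AgreeUpTo.shift {n : ℕ} {c d : Series m} (h : AgreeUpTo (n + 1) c d)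
    (k : Fin (m + 1)) : AgreeUpTo n (shift k c) (shift k d) :=
  fun ν hν => h (k :: ν) (by simpa using hν)

theorem AgreeUpTo.mono {n n' : ℕ} {c d : Series m} (h : AgreeUpTo n c d) (hn : n' ≤ n) :
    AgreeUpTo n' c d :=
  fun ν hν => h ν (hν.trans hn)

theorem AgreeUpTo.add {n : ℕ} {a b c d : Series m} (h₁ : AgreeUpTo n a b)
    (h₂ : AgreeUpTo n c d) : AgreeUpTo n (a + c) (b + d) :=
  fun ν hν => congrArg₂ (· + ·) (h₁ ν hν) (h₂ ν hν)

theorem AgreeUpTo.sum {ι : Type*} {s : Finset ι} {n : ℕ} {f g : ι → Series m}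
    (h : ∀ i, AgreeUpTo n (f i) (g i)) : AgreeUpTo n (∑ i ∈ s, f i) (∑ i ∈ s, g i) := by
  intro ν hν
  simp only [Finset.sum_apply]
  exact Finset.sum_congr rfl fun i _ => h i ν hν

theorem eq_of_agreeUpTo {c d : Series m} (h : ∀ n, AgreeUpTo n c d) : c = d :=
  funext fun ν => h ν.length ν le_rfl

theorem finsum_eq_finsum_comp {α β : Type*} {g : β → α} (hg : Function.Injective g)
    {F : α → ℝ} (hF : ∀ a, a ∉ Set.range g → F a = 0) : ∑ᶠ a, F a = ∑ᶠ b, F (g b) := by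
  rw [← finsum_mem_range hg, finsum_mem_def]
  refine finsum_congr fun a => ?_
  by_cases h : a ∈ Set.range g
  · rw [Set.indicator_of_mem h]
  · rw [Set.indicator_of_notMem h, hF a h]

theorem finsum_word {f : Word m → ℝ} (hf : f.support.Finite) :
    ∑ᶠ η, f η = f [] + ∑ i, ∑ᶠ η, f (i :: η) := by
  let F (o : Option (Fin (m + 1))) (η : Word m) : ℝ := if η.head? = o then f η else 0
  have hF : ∀ o, (F o).support.Finite := fun o => hf.subset fun η hη h => hη (by simp [F, h])
  have hsplit : ∀ η, f η = ∑ o, F o η := fun η => by simp [F]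
  rw [finsum_congr hsplit, finsum_sum_comm _ _ fun o _ => hF o, Fintype.sum_option]
  congr 1
  · rw [finsum_eq_single _ []]
    · simp
    · intro η hη
      simp [hη]
  · refine Finset.sum_congr rfl fun i _ => ?_
    rw [finsum_eq_finsum_comp (g := fun η : Word m => i :: η) (List.cons_injective)]
    · simp
    · rintro (_ | ⟨j, η⟩) h
      · simp
      · have : j ≠ i := by
          rintro rfl
          exact h ⟨η, rfl⟩
        simp [this]

theorem shw_nil_left (ξ ν : Word m) : shw m [] ξ ν = if ν = ξ then 1 else 0 := by
  rw [shw]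

theorem shw_nil_right (η ν : Word m) : shw m η [] ν = if ν = η then 1 else 0 := by
  cases η with
  | nil => rw [shw]
  | cons i η =>
    rw [shw]
    simp

theorem shw_cons_cons (i j : Fin (m + 1)) (η ξ : Word m) :
    shw m (i :: η) (j :: ξ) = cat m i (shw m η (j :: ξ)) + cat m j (shw m (i :: η) ξ) := by
  rw [shw]

theorem shw_apply_nil (η ξ : Word m) :
    shw m η ξ [] = if η = [] ∧ ξ = [] then 1 else 0 := by
  rcases η with _ | ⟨i, η⟩
  · simp [shw_nil_left, eq_comm]
  · rcases ξ with _ | ⟨j, ξ⟩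
    · simp [shw_nil_right]
    · simp [shw_cons_cons, cat]

/-- The function `x_k η ↦ f η`, extended by zero to words not starting with `x_k`. -/
def unconsAt (k : Fin (m + 1)) (f : Word m → ℝ) : Word m → ℝ
  | [] => 0
  | i :: η => if k = i then f η else 0

theorem shw_apply_cons (η ξ : Word m) (k : Fin (m + 1)) (ν : Word m) :
    shw m η ξ (k :: ν) =
      unconsAt k (fun η' => shw m η' ξ ν) η + unconsAt k (fun ξ' => shw m η ξ' ν) ξ := by
  rcases η with _ | ⟨i, η⟩ <;> rcases ξ with _ | ⟨j, ξ⟩ <;>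
    simp [shw_nil_left, shw_nil_right, shw_cons_cons, cat, unconsAt, ite_and]

theorem shw_eq_zero {η ξ ν : Word m} (h : ν.length ≠ η.length + ξ.length) :
    shw m η ξ ν = 0 := by
  induction ν generalizing η ξ with
  | nil =>
    rw [shw_apply_nil, if_neg]
    rintro ⟨rfl, rfl⟩
    simp at h
  | cons k ν ih =>
    rw [shw_apply_cons]
    have h₁ : unconsAt k (fun η' => shw m η' ξ ν) η = 0 := by
      rcases η with _ | ⟨i, η⟩
      · rfl
      · simp only [unconsAt]
        rw [ih (by simp at h; omega), ite_self]
    have h₂ : unconsAt k (fun ξ' => shw m η ξ' ν) ξ = 0 := by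
      rcases ξ with _ | ⟨i, ξ⟩
      · rfl
      · simp only [unconsAt]
        rw [ih (by simp at h; omega), ite_self]
    rw [h₁, h₂, add_zero]

theorem finite_word_pairs (n : ℕ) :
    {p : Word m × Word m | p.1.length + p.2.length ≤ n}.Finite :=
  ((List.finite_length_le (Fin (m + 1)) n).prod (List.finite_length_le (Fin (m + 1)) n)).subset
    fun p hp => by
      simp only [Set.mem_ofPred_eq, Set.mem_prod] at hp ⊢
      omega

theorem sh_apply_nil (c d : Series m) : sh m c d [] = c [] * d [] := by
  rw [sh, finsum_eq_single _ ([], [])]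
  · simp [shw_apply_nil]
  · rintro ⟨η, ξ⟩ h
    have : ¬(η = [] ∧ ξ = []) := by simpa using h
    simp [shw_apply_nil, this]

theorem shift_sh (k : Fin (m + 1)) (c d : Series m) :
    shift k (sh m c d) = sh m (shift k c) d + sh m c (shift k d) := by
  funext ν
  simp only [shift, sh, Pi.add_apply, shw_apply_cons, mul_add]
  rw [finsum_add_distrib]
  · congr 1
    · rw [finsum_eq_finsum_comp (g := fun p : Word m × Word m => (k :: p.1, p.2))]
      · simp [unconsAt]
      · rintro ⟨a, b⟩ ⟨a', b'⟩ h
        simpa using h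
      · rintro ⟨_ | ⟨i, η⟩, ξ⟩ h
        · simp [unconsAt]
        · have : k ≠ i := by
            rintro rfl
            exact h ⟨(η, ξ), rfl⟩
          simp [unconsAt, this]
    · rw [finsum_eq_finsum_comp (g := fun p : Word m × Word m => (p.1, k :: p.2))]
      · simp [unconsAt]
      · rintro ⟨a, b⟩ ⟨a', b'⟩ h
        simpa using h
      · rintro ⟨η, _ | ⟨i, ξ⟩⟩ h
        · simp [unconsAt]
        · have : k ≠ i := by
            rintro rfl
            exact h ⟨(η, ξ), rfl⟩
          simp [unconsAt, this]
  · refine (finite_word_pairs (ν.length + 1)).subset ?_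
    rintro ⟨_ | ⟨i, η⟩, ξ⟩ h
    · simp [unconsAt] at h
    · by_contra hlt
      refine h ?_
      simp only [Set.mem_ofPred_eq, List.length_cons] at hlt
      simp only [unconsAt]
      rw [shw_eq_zero (by omega), ite_self, mul_zero]
  · refine (finite_word_pairs (ν.length + 1)).subset ?_
    rintro ⟨η, _ | ⟨i, ξ⟩⟩ h
    · simp [unconsAt] at h
    · by_contra hlt
      refine h ?_
      simp only [Set.mem_ofPred_eq, List.length_cons] at hlt
      simp only [unconsAt]
      rw [shw_eq_zero (by omega), ite_self, mul_zero]

theorem sh_apply_cons (c d : Series m) (k : Fin (m + 1)) (ν : Word m) :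
    sh m c d (k :: ν) = sh m (shift k c) d ν + sh m c (shift k d) ν :=
  congrFun (shift_sh k c d) ν

theorem sh_comm (c d : Series m) : sh m c d = sh m d c := by
  funext ν
  induction ν generalizing c d with
  | nil => rw [sh_apply_nil, sh_apply_nil, mul_comm]
  | cons k ν ih => rw [sh_apply_cons, sh_apply_cons, ih, ih c, add_comm]

theorem sh_add (a c d : Series m) : sh m a (c + d) = sh m a c + sh m a d := by
  funext ν
  induction ν generalizing a c d with
  | nil => simp [sh_apply_nil, mul_add]
  | cons k ν ih =>
    simp only [Pi.add_apply] at ih ⊢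
    simp only [sh_apply_cons, shift_add, ih]
    ring

theorem add_sh (a c d : Series m) : sh m (c + d) a = sh m c a + sh m d a := by
  rw [sh_comm, sh_add, sh_comm a, sh_comm a]

theorem sh_zero (a : Series m) : sh m a 0 = 0 := by
  simpa using sh_add a 0 0

theorem zero_sh (a : Series m) : sh m 0 a = 0 := by
  rw [sh_comm, sh_zero]

theorem sum_sh {ι : Type*} (s : Finset ι) (f : ι → Series m) (a : Series m) :
    sh m (∑ i ∈ s, f i) a = ∑ i ∈ s, sh m (f i) a :=
  map_sum (AddMonoidHom.mk' (fun c => sh m c a) (add_sh a)) f s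

theorem sh_assoc (a b c : Series m) : sh m (sh m a b) c = sh m a (sh m b c) := by
  funext ν
  induction ν generalizing a b c with
  | nil => simp only [sh_apply_nil, mul_assoc]
  | cons k ν ih =>
    simp only [sh_apply_cons, shift_sh, add_sh, sh_add, Pi.add_apply, ih]
    ring

theorem AgreeUpTo.sh {n : ℕ} {a b : Series m} (c : Series m) (h : AgreeUpTo n a b) :
    AgreeUpTo n (sh m c a) (sh m c b) := by
  intro ν hν
  induction ν generalizing a b c n with
  | nil => rw [sh_apply_nil, sh_apply_nil, h [] hν]
  | cons k ν ih =>
    obtain ⟨n, rfl⟩ : ∃ n', n = n' + 1 := ⟨n - 1, by simp at hν; omega⟩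
    have hν' : ν.length ≤ n := by simpa using hν
    rw [sh_apply_cons, sh_apply_cons, ih _ (h.mono n.le_succ) hν', ih _ (h.shift k) hν']

theorem finite_support_sh {f : Word m → Series m}
    (hf : ∀ ξ, (Function.support fun η => f η ξ).Finite) (c : Series m) (ν : Word m) :
    (Function.support fun η => sh m c (f η) ν).Finite := by
  induction ν generalizing c f with
  | nil =>
    refine (hf []).subset fun η hη h => hη ?_
    simp only [sh_apply_nil, h, mul_zero]
  | cons k ν ih =>
    simp only [sh_apply_cons]
    exact ((ih hf _).union (ih (f := fun η => shift k (f η)) (fun ξ => hf (k :: ξ)) c)).subset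
      (Function.support_add _ _)

theorem finite_support_mul {f : Word m → ℝ} (hf : f.support.Finite) (a : Word m → ℝ) :
    (Function.support fun η => a η * f η).Finite :=
  hf.subset fun η hη h => hη (by simp only [h, mul_zero])

theorem sh_finsum {f : Word m → Series m}
    (hf : ∀ ξ, (Function.support fun η => f η ξ).Finite) (a : Word m → ℝ) (c : Series m)
    (ν : Word m) :
    sh m c (fun ξ => ∑ᶠ η, a η * f η ξ) ν = ∑ᶠ η, a η * sh m c (f η) ν := by
  induction ν generalizing c f with
  | nil =>
    simp only [sh_apply_nil]
    rw [mul_finsum]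
    exact finsum_congr fun η => by ring
  | cons k ν ih =>
    have hk : ∀ ξ, (Function.support fun η => shift k (f η) ξ).Finite := fun ξ => hf (k :: ξ)
    simp only [sh_apply_cons, mul_add]
    rw [finsum_add_distrib (finite_support_mul (finite_support_sh hf _ ν) a)
      (finite_support_mul (finite_support_sh hk _ ν) a), ← ih hf, ← ih hk]
    rfl

theorem phi_one_eq_zero (d : Fin m → Series m) {η ν : Word m} (h : ν.length < η.length) :
    phi m d η (one m) ν = 0 := by
  induction η generalizing ν with
  | nil => simp at h
  | cons i η ih =>
    rcases ν with _ | ⟨k, ν⟩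
    · simp [phi, phiStep, cat]
    · have hν : ν.length < η.length := by simpa using h
      have hagree : AgreeUpTo ν.length (phi m d η (one m)) 0 :=
        fun ξ hξ => ih (hξ.trans_lt hν)
      have hsh := hagree.sh (dsel m d i) ν le_rfl
      rw [sh_zero] at hsh
      simp [phi, phiStep, cat, ih hν, hsh]

theorem finite_support_phi_one (d : Fin m → Series m) (ν : Word m) :
    (Function.support fun η => phi m d η (one m) ν).Finite :=
  (List.finite_length_le (Fin (m + 1)) ν.length).subset fun η hη => by
    by_contra h
    exact hη (phi_one_eq_zero d (by simpa using h))

theorem modcomp_apply_nil (c : Series m) (d : Fin m → Series m) :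
    modcomp m c d [] = c [] := by
  rw [modcomp, finsum_eq_single _ []]
  · simp [phi, one]
  · rintro (_ | ⟨i, η⟩) h
    · exact absurd rfl h
    · simp [phi, phiStep, cat]

theorem shift_modcomp (k : Fin (m + 1)) (c : Series m) (d : Fin m → Series m) :
    shift k (modcomp m c d) = modcomp m (shift k c) d +
      if k = 0 then ∑ i, sh m (dsel m d i) (modcomp m (shift i c) d) else 0 := by
  funext ν
  have hφ := finite_support_phi_one d
  have hterm : ∀ i, ∑ᶠ η, c (i :: η) * phi m d (i :: η) (one m) (k :: ν) =
      (if k = i then modcomp m (shift i c) d ν else 0) +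
        if k = 0 then sh m (dsel m d i) (modcomp m (shift i c) d) ν else 0 := by
    intro i
    have h₁ : (Function.support fun η => if k = i then phi m d η (one m) ν else 0).Finite :=
      (hφ ν).subset fun η hη h => hη (by simp only [h, ite_self])
    have h₂ : (Function.support fun η =>
        if k = 0 then sh m (dsel m d i) (phi m d η (one m)) ν else 0).Finite :=
      (finite_support_sh hφ (dsel m d i) ν).subset fun η hη h => hη (by simp only [h, ite_self])
    simp only [phi, phiStep, cat, Pi.add_apply, mul_add]
    rw [finsum_add_distrib (finite_support_mul h₁ _) (finite_support_mul h₂ _)]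
    congr 1
    · split_ifs <;> simp [modcomp, shift]
    · split_ifs
      · exact (sh_finsum hφ (shift i c) (dsel m d i) ν).symm
      · simp
  simp only [shift, modcomp] at hterm ⊢
  rw [finsum_word (finite_support_mul (hφ (k :: ν)) c), Finset.sum_congr rfl fun i _ => hterm i,
    Finset.sum_add_distrib]
  split_ifs <;> simp [phi, one, modcomp, Finset.sum_apply, shift]

theorem add_modcomp (a b : Series m) (d : Fin m → Series m) :
    modcomp m (a + b) d = modcomp m a d + modcomp m b d := by
  funext ν
  have hφ := finite_support_phi_one d ν
  simp only [modcomp, Pi.add_apply, add_mul]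
  exact finsum_add_distrib (finite_support_mul hφ a) (finite_support_mul hφ b)

theorem zero_modcomp (d : Fin m → Series m) : modcomp m 0 d = 0 := by
  simpa using add_modcomp 0 0 d

theorem sum_modcomp {ι : Type*} (s : Finset ι) (f : ι → Series m) (d : Fin m → Series m) :
    modcomp m (∑ i ∈ s, f i) d = ∑ i ∈ s, modcomp m (f i) d :=
  map_sum (AddMonoidHom.mk' (fun c => modcomp m c d) fun a b => add_modcomp a b d) f s

/-- Right composition is a homomorphism of the shuffle algebra. -/
theorem sh_modcomp (a b : Series m) (d : Fin m → Series m) :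
    modcomp m (sh m a b) d = sh m (modcomp m a d) (modcomp m b d) := by
  refine eq_of_agreeUpTo fun n => ?_
  induction n using Nat.strong_induction_on generalizing a b with
  | _ n ih =>
    refine .of_shift (by simp only [modcomp_apply_nil, sh_apply_nil]) fun k n' hn' => ?_
    have hrhs : shift k (sh m (modcomp m a d) (modcomp m b d)) =
        (sh m (modcomp m (shift k a) d) (modcomp m b d) +
          sh m (modcomp m a d) (modcomp m (shift k b) d)) +
        if k = 0 then ∑ i, sh m (dsel m d i)
          (sh m (modcomp m (shift i a) d) (modcomp m b d) +
            sh m (modcomp m a d) (modcomp m (shift i b) d)) else 0 := by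
      rw [shift_sh, shift_modcomp, shift_modcomp]
      split_ifs
      · simp only [sh_add, add_sh, Finset.sum_add_distrib, sum_sh, sh_assoc,
          sh_comm (modcomp m a d) (∑ i, _)]
        simp only [sh_comm _ (modcomp m a d)]
        abel
      · simp
    rw [hrhs, shift_modcomp]
    have hshift : ∀ i, AgreeUpTo n' (modcomp m (shift i (sh m a b)) d)
        (sh m (modcomp m (shift i a) d) (modcomp m b d) +
          sh m (modcomp m a d) (modcomp m (shift i b) d)) := fun i => by
      rw [shift_sh, add_modcomp]
      exact (ih n' hn' _ _).add (ih n' hn' _ _)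
    refine (hshift k).add ?_
    split_ifs
    · exact .sum fun i => (hshift i).sh _
    · exact fun _ _ => rfl

theorem dsel_zero (d : Fin m → Series m) : dsel m d 0 = 0 := by
  simp [dsel]

theorem dsel_add_modcompV (d e : Fin m → Series m) (i : Fin (m + 1)) :
    dsel m (e + modcompV m d e) i = dsel m e i + modcomp m (dsel m d i) e := by
  by_cases h : i = 0
  · subst h
    simp [dsel_zero, zero_modcomp]
  · simp [dsel, h, modcompV]

theorem modcomp_modcomp (c : Series m) (d e : Fin m → Series m) :
    modcomp m (modcomp m c d) e = modcomp m c (e + modcompV m d e) := by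
  refine eq_of_agreeUpTo fun n => ?_
  induction n using Nat.strong_induction_on generalizing c with
  | _ n ih =>
    refine .of_shift (by simp only [modcomp_apply_nil]) fun k n' hn' => ?_
    have hsel : ∀ i, sh m (dsel m e i) (modcomp m (shift i (modcomp m c d)) e) =
        sh m (dsel m e i) (modcomp m (modcomp m (shift i c) d) e) := by
      intro i
      by_cases h : i = 0
      · subst h
        simp only [dsel_zero, zero_sh]
      · rw [shift_modcomp, if_neg h, add_zero]
    have hlhs : shift k (modcomp m (modcomp m c d) e) =
        modcomp m (modcomp m (shift k c) d) e +
          if k = 0 then ∑ i, sh m (dsel m (e + modcompV m d e) i)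
            (modcomp m (modcomp m (shift i c) d) e) else 0 := by
      rw [shift_modcomp, Finset.sum_congr rfl fun i _ => hsel i, shift_modcomp, add_modcomp]
      split_ifs
      · simp only [sum_modcomp, sh_modcomp, dsel_add_modcompV, add_sh, Finset.sum_add_distrib]
        abel
      · simp [zero_modcomp]
    rw [hlhs, shift_modcomp]
    refine (ih n' hn' _).add ?_
    split_ifs
    · exact .sum fun i => (ih n' hn' _).sh _
    · exact fun _ _ => rfl

end Auxiliary

/-- The mixed composition product satisfies mixed associativity:
`(c ∘̃ d) ∘̃ e = c ∘̃ (e + d ∘̃ e)`; consequently the group product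
`c_δ ∘ d_δ = δ + d + c ∘̃ d` on `ℝ^m⟨⟨X_δ⟩⟩` is associative, i.e. the induced
operation `c ⊚ d = d + c ∘̃ d` is associative. -/
theorem mixed_associativity (m ℓ : ℕ) :
    (∀ (c : Fin ℓ → Series m) (d e : Fin m → Series m),
      modcompV m (modcompV m c d) e = modcompV m c (e + modcompV m d e)) ∧
    (∀ c d e : Fin m → Series m, gprod m (gprod m c d) e = gprod m c (gprod m d e)) := by
  have hmixed {ℓ : ℕ} (c : Fin ℓ → Series m) (d e : Fin m → Series m) :
      modcompV m (modcompV m c d) e = modcompV m c (e + modcompV m d e) :=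
    funext fun j => modcomp_modcomp (c j) d e
  refine ⟨hmixed, fun c d e => ?_⟩
  have hadd : modcompV m (d + modcompV m c d) e =
      modcompV m d e + modcompV m (modcompV m c d) e :=
    funext fun j => add_modcomp (d j) (modcompV m c d j) e
  simp only [gprod]
  rw [hadd, hmixed, add_assoc]

end

end FliessStmt
end

section
/- In the Hopf algebra H of coordinate functions, the coproduct of any generator simplifies to Δ a^l_η = Θ̃_η(a^l_∅ ⊗ 1) + 1 ⊗ a^l_η for every word η ∈ X* and 1 ≤ l ≤ m. -/
open scoped TensorProduct BigOperators

namespace FeedbackHopf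

/-- Words over the alphabet `X = {x_0, …, x_m}`. -/
abbrev Word (m : ℕ) := List (Fin (m + 1))

/-- `H`: the free commutative polynomial ℝ-algebra on the coordinate-function
generators `a^k_η`, `η ∈ X*`, `1 ≤ k ≤ m`. -/
abbrev H (m : ℕ) := MvPolynomial (Fin m × Word m) ℝ

noncomputable section

variable (m : ℕ)

/-- The generator (coordinate function) `a^k_η`. -/
def gen (k : Fin m) (η : Word m) : H m := MvPolynomial.X (k, η)

/-- The right-shift map `θ̃_j`: the derivation of `H` with `θ̃_j a^k_η = a^k_{η x_j}`. -/
def theta (j : Fin (m + 1)) : H m →ₗ[ℝ] H m :=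
  (MvPolynomial.mkDerivation ℝ fun p : Fin m × Word m =>
    (MvPolynomial.X (p.1, p.2 ++ [j]) : H m)).toLinearMap

/-- The map `A^{(j)} : H → H`, multiplication by `a^j_∅`. -/
def Ae (j : Fin m) : H m →ₗ[ℝ] H m := LinearMap.mulRight ℝ (gen m j [])

/-- `Θ̃_i := θ̃_i ⊗ id + id ⊗ θ̃_i + δ_{0i} Σ_{j=1}^m θ̃_j ⊗ A^{(j)}` on `H ⊗ H`. -/
def thetaT (i : Fin (m + 1)) : H m ⊗[ℝ] H m →ₗ[ℝ] H m ⊗[ℝ] H m :=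
  TensorProduct.map (theta m i) LinearMap.id
    + TensorProduct.map LinearMap.id (theta m i)
    + (if i = 0 then ∑ j : Fin m, TensorProduct.map (theta m j.succ) (Ae m j) else 0)

/-- `Θ̃_η := Θ̃_{i_n} ∘ ⋯ ∘ Θ̃_{i_1}` for `η = x_{i_1} ⋯ x_{i_n}`, `Θ̃_∅ = id`. -/
def thetaTw : Word m → (H m ⊗[ℝ] H m →ₗ[ℝ] H m ⊗[ℝ] H m)
  | [] => LinearMap.id
  | i :: η => thetaTw η ∘ₗ thetaT m i

/-- The coproduct `Δ`, defined on generators by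
`Δ a^l_η := Θ̃_η (a^l_∅ ⊗ 1 + 1 ⊗ a^l_∅)` and extended as an algebra morphism. -/
def Delta : H m →ₐ[ℝ] H m ⊗[ℝ] H m :=
  MvPolynomial.aeval fun p : Fin m × Word m =>
    thetaTw m p.2 (gen m p.1 [] ⊗ₜ[ℝ] 1 + 1 ⊗ₜ[ℝ] gen m p.1 [])

/-- The counit `ε`, with `ε(a^k_η) = 0` and `ε(1) = 1`. -/
def counit : H m →ₐ[ℝ] ℝ := MvPolynomial.aeval fun _ => (0 : ℝ)

theorem theta_one (j : Fin (m + 1)) : theta m j 1 = 0 := by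
  simp [theta]

theorem theta_gen (j : Fin (m + 1)) (k : Fin m) (η : Word m) :
    theta m j (gen m k η) = gen m k (η ++ [j]) := by
  simp [theta, gen, MvPolynomial.mkDerivation_X]

/-- On `1 ⊗ H` the operator `Θ̃_i` reduces to `id ⊗ θ̃_i`. -/
theorem thetaT_one_tmul (i : Fin (m + 1)) (h : H m) :
    thetaT m i (1 ⊗ₜ[ℝ] h) = 1 ⊗ₜ[ℝ] theta m i h := by
  unfold thetaT
  split_ifs <;> simp [theta_one, LinearMap.sum_apply]

theorem thetaTw_one_tmul_gen (η ξ : Word m) (l : Fin m) :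
    thetaTw m η (1 ⊗ₜ[ℝ] gen m l ξ) = 1 ⊗ₜ[ℝ] gen m l (ξ ++ η) := by
  induction η generalizing ξ with
  | nil => simp [thetaTw]
  | cons i η ih => simp [thetaTw, thetaT_one_tmul, theta_gen, ih]

/-- The coproduct of any generator simplifies to
`Δ a^l_η = Θ̃_η(a^l_∅ ⊗ 1) + 1 ⊗ a^l_η`. -/
theorem coproduct_simplified (m : ℕ) (η : Word m) (l : Fin m) :
    Delta m (gen m l η)
      = thetaTw m η (gen m l [] ⊗ₜ[ℝ] 1) + 1 ⊗ₜ[ℝ] gen m l η := by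
  have hΔ : Delta m (gen m l η)
      = thetaTw m η (gen m l [] ⊗ₜ[ℝ] 1 + 1 ⊗ₜ[ℝ] gen m l []) :=
    MvPolynomial.aeval_X _ _
  rw [hΔ, map_add, thetaTw_one_tmul_gen, List.nil_append]

end

end FeedbackHopf
end
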